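/- Define, for a list L over a type α, the multiset of splits: splits L := the multiset of pairs (L.take i, L.drop i) for i = 0, 1, …, L.length. Then the shuffle product and the deconcatenation coproduct are compatible: for any two lists A and B, (shuffles A B).bind (fun C => splits C) = (splits A).bind (fun (A₁, A₂) => (splits B).bind (fun (B₁, B₂) => (shuffles A₁ B₁).bind (fun C₁ => (shuffles A₂ B₂).map (fun C₂ => (C₁, C₂))))) as multisets of pairs of lists. -/

import Mathlib

/-- The multiset of shuffles (interleavings) of two lists. -/
def shuffles {α : Type*} : List α → List α → Multiset (List α)
  | [], B => {B}
  | A, [] => {A}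
  | a :: A, b :: B =>
      ((shuffles A (b :: B)).map (a :: ·)) + ((shuffles (a :: A) B).map (b :: ·))
  termination_by A B => A.length + B.length
  decreasing_by all_goals simp

/-- The multiset of splits (deconcatenations) of a list into a prefix and a suffix. -/
def splits {α : Type*} (L : List α) : Multiset (List α × List α) :=
  (Multiset.range (L.length + 1)).map (fun i => (L.take i, L.drop i))

@[simp]
theorem shuffles_nil_left {α : Type*} (B : List α) : shuffles [] B = {B} := by
  simp [shuffles]

@[simp]
theorem shuffles_nil_right {α : Type*} (A : List α) : shuffles A [] = {A} := by
  cases A <;> simp [shuffles]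

theorem shuffles_cons_cons {α : Type*} (a b : α) (A B : List α) :
    shuffles (a :: A) (b :: B) =
      (shuffles A (b :: B)).map (a :: ·) + (shuffles (a :: A) B).map (b :: ·) := by
  rw [shuffles]

@[simp]
theorem splits_nil {α : Type*} : splits ([] : List α) = {([], [])} := by
  simp [splits]

theorem splits_cons {α : Type*} (a : α) (L : List α) :
    splits (a :: L) = {([], a :: L)} + (splits L).map (fun p => (a :: p.1, p.2)) := by
  simp only [splits, Multiset.range, List.length_cons, Multiset.map_coe,
    List.range_succ_eq_map (n := L.length + 1), List.map_cons, List.map_map,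
    Multiset.singleton_add, Multiset.cons_coe]
  rfl

theorem bind_splits_map_cons {α : Type*} (a : α) (S : Multiset (List α)) :
    (S.map (a :: ·)).bind splits =
      S.map (fun C => ([], a :: C)) + (S.bind splits).map (fun p => (a :: p.1, p.2)) := by
  simp only [Multiset.bind_map, splits_cons, Multiset.bind_add, Multiset.bind_singleton,
    Multiset.map_bind]

/-- Compatibility of the shuffle product with the deconcatenation coproduct:
deconcatenation is an algebra homomorphism for the shuffle product. -/
theorem splits_shuffles_compat {α : Type*} (A B : List α) :
    (shuffles A B).bind (fun C => splits C) =
      (splits A).bind (fun A' =>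
        (splits B).bind (fun B' =>
          (shuffles A'.1 B'.1).bind (fun C₁ =>
            (shuffles A'.2 B'.2).map (fun C₂ => (C₁, C₂))))) := by
  induction A generalizing B with
  | nil => simpa using ((Multiset.bind_singleton _ id).trans (Multiset.map_id _)).symm
  | cons a A ihA =>
    induction B with
    | nil => simpa using ((Multiset.bind_singleton _ id).trans (Multiset.map_id _)).symm
    | cons b B ihB =>
      rw [shuffles_cons_cons, Multiset.add_bind, bind_splits_map_cons, bind_splits_map_cons,
        ihA, ihB]
      simp only [splits_cons, Multiset.add_bind, Multiset.bind_add, Multiset.singleton_bind,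
        Multiset.bind_map, Multiset.map_bind, Multiset.map_add, Multiset.map_map,
        shuffles_nil_left, shuffles_nil_right, shuffles_cons_cons, Function.comp_def]
      abel
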